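/- arXiv:1009.4305 — 2 statements merged into one kernel-verified Lean document; each statement's English description precedes it below -/
import Mathlib

section
/- Γ-liminf inequality for the regularized functionals: let ε_n ↓ 0, let ρ_n = u_n·ℒ¹ be absolutely continuous finite nonnegative Borel measures on ℝ with ρ_n(ℝ) = m which converge weakly to a finite nonnegative Borel measure ρ = u·ℒ¹ + ρ⊥ in duality with bounded continuous functions, and suppose limsup_n ∫_ℝ x² dρ_n(x) < +∞. Then liminf_{n→∞} [ ∫_ℝ E(u_n) dx + ε_n ∫_ℝ u_n log u_n dx + ∫_ℝ V_n dρ_n ] ≥ ∫_ℝ E(u) dx + ∫_ℝ V dρ. -/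
open MeasureTheory Set Filter Topology
open scoped ENNReal

noncomputable def Edens (β : ℝ → ℝ) (r : ℝ) : ℝ :=
  -β r - r * ∫ s in Set.Ioi r, deriv β s / s

noncomputable def erealInt (f : ℝ → ℝ) (μ : Measure ℝ) : EReal :=
  ((∫⁻ x, ENNReal.ofReal (f x) ∂μ : ℝ≥0∞) : EReal)
    - ((∫⁻ x, ENNReal.ofReal (-(f x)) ∂μ : ℝ≥0∞) : EReal)

/-- The entropy functional `F(ρ) = ∫ E(u) dx + ∫ V dρ`, with values in `[-∞,+∞]`,
where `u` is the density of the absolutely continuous part of `ρ`; by convention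
`F(ρ) = +∞` whenever `∫ V dρ = +∞` (i.e. the positive part of `V` is not `ρ`-integrable). -/
noncomputable def Fent (β V : ℝ → ℝ) (ρ : Measure ℝ) : EReal :=
  if (∫⁻ x, ENNReal.ofReal (V x) ∂ρ) = ⊤ then ⊤
  else
    (-(((∫⁻ x, ENNReal.ofReal (-(Edens β ((ρ.rnDeriv volume x).toReal)))) : ℝ≥0∞) : EReal))
      + erealInt V ρ

lemma bderiv_nonneg {β : ℝ → ℝ} (hβmono : StrictMonoOn β (Set.Ici 0)) {s : ℝ} (hs : 0 < s) :
    0 ≤ deriv β s := by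
  rw [← derivWithin_of_mem_nhds (Ici_mem_nhds hs)]
  exact hβmono.monotoneOn.derivWithin_nonneg

lemma bderiv_int {β : ℝ → ℝ} {βinf : ℝ} (hβ : ContDiff ℝ 1 β)
    (hβmono : StrictMonoOn β (Set.Ici 0))
    (hβlim : Tendsto β atTop (𝓝 βinf)) {t : ℝ} (ht : 0 ≤ t) :
    IntegrableOn (deriv β) (Ioi t) := by
  refine integrableOn_Ioi_deriv_of_nonneg' (g := β) (l := βinf) ?_ ?_ hβlim
  · intro x _
    exact (hβ.differentiable (by norm_num) x).hasDerivAt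
  · intro x hx
    exact bderiv_nonneg hβmono (lt_of_le_of_lt ht hx)

lemma bderiv_div_int {β : ℝ → ℝ} {βinf : ℝ} (hβ : ContDiff ℝ 1 β)
    (hβmono : StrictMonoOn β (Set.Ici 0))
    (hβlim : Tendsto β atTop (𝓝 βinf)) {t : ℝ} (ht : 0 < t) :
    IntegrableOn (fun s => deriv β s / s) (Ioi t) := by
  have h1 := (bderiv_int hβ hβmono hβlim ht.le).div_const t
  refine Integrable.mono' h1 ?_ ?_
  · have : Measurable (deriv β) := measurable_deriv β
    exact (this.div measurable_id).aestronglyMeasurable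
  · filter_upwards [ae_restrict_mem measurableSet_Ioi] with s hs
    have hs' : t < s := hs
    have := bderiv_nonneg hβmono (ht.trans hs')
    rw [Real.norm_of_nonneg (div_nonneg this (ht.trans hs').le)]
    gcongr

lemma Fform {β : ℝ → ℝ} {βinf : ℝ} (hβ : ContDiff ℝ 1 β)
    (hβmono : StrictMonoOn β (Set.Ici 0)) (hβ0 : β 0 = 0)
    (hβlim : Tendsto β atTop (𝓝 βinf)) {t : ℝ} (ht : 0 ≤ t) :
    ENNReal.ofReal (-(Edens β t)) =
      ∫⁻ s in Ioi (0:ℝ), ENNReal.ofReal (deriv β s / s) * ENNReal.ofReal (min s t) := by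
  rcases ht.eq_or_lt with rfl | ht
  · rw [setLIntegral_congr_fun (g := fun _ => 0) measurableSet_Ioi]
    · simp [Edens, hβ0]
    · intro s hs
      have : min s 0 = (0:ℝ) := min_eq_right (le_of_lt hs)
      simp [this]
  · have hmono := hβmono
    rw [← Ioc_union_Ioi_eq_Ioi ht.le, lintegral_union measurableSet_Ioi
      (by rw [Set.disjoint_left]; intro x hx hx'; exact absurd hx.2 (not_le.2 hx'))]
    have e1 : ∫⁻ s in Ioc 0 t, ENNReal.ofReal (deriv β s / s) * ENNReal.ofReal (min s t)
        = ENNReal.ofReal (β t) := by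
      rw [setLIntegral_congr_fun (g := fun s => ENNReal.ofReal (deriv β s)) measurableSet_Ioc]
      · rw [← ofReal_integral_eq_lintegral_ofReal]
        · congr 1
          rw [← intervalIntegral.integral_of_le ht.le, intervalIntegral.integral_deriv_eq_sub]
          · simp [hβ0]
          · intro x _; exact hβ.differentiable (by norm_num) x
          · exact (hβ.continuous_deriv (by norm_num)).intervalIntegrable _ _
        · exact ((bderiv_int hβ hβmono hβlim le_rfl).mono_set Ioc_subset_Ioi_self)
        · filter_upwards [ae_restrict_mem measurableSet_Ioc] with s hs
          exact bderiv_nonneg hβmono hs.1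
      · intro s hs
        have h1 := bderiv_nonneg hβmono hs.1
        simp only
        rw [min_eq_left hs.2, ← ENNReal.ofReal_mul (div_nonneg h1 hs.1.le),
          div_mul_cancel₀ _ hs.1.ne']
    have e2 : ∫⁻ s in Ioi t, ENNReal.ofReal (deriv β s / s) * ENNReal.ofReal (min s t)
        = ENNReal.ofReal (t * ∫ s in Ioi t, deriv β s / s) := by
      rw [mul_comm t, ENNReal.ofReal_mul', ofReal_integral_eq_lintegral_ofReal
        (bderiv_div_int hβ hβmono hβlim ht), ← lintegral_mul_const']
      · apply setLIntegral_congr_fun measurableSet_Ioi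
        intro s hs
        simp only
        rw [min_eq_right (le_of_lt hs)]
      · simp
      · filter_upwards [ae_restrict_mem measurableSet_Ioi] with s hs
        exact div_nonneg (bderiv_nonneg hβmono (ht.trans hs)) (ht.trans hs).le
      · exact ht.le
    rw [e1, e2, ← ENNReal.ofReal_add]
    · congr 1
      unfold Edens; ring
    · rw [← hβ0]; exact hβmono.monotoneOn (by simp) ht.le ht.le
    · apply mul_nonneg ht.le
      apply setIntegral_nonneg measurableSet_Ioi
      intro s hs
      exact div_nonneg (bderiv_nonneg hβmono (ht.trans hs)) (ht.trans hs).le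

lemma Edens_nonpos {β : ℝ → ℝ} 
    (hβmono : StrictMonoOn β (Set.Ici 0)) (hβ0 : β 0 = 0) {t : ℝ} (ht : 0 ≤ t) :
    Edens β t ≤ 0 := by
  have h1 : 0 ≤ β t := by
    rw [← hβ0]; exact hβmono.monotoneOn (by simp) ht ht
  have h2 : 0 ≤ t * ∫ s in Set.Ioi t, deriv β s / s := by
    apply mul_nonneg ht
    apply setIntegral_nonneg measurableSet_Ioi
    intro s hs
    have hs' : t < s := hs
    exact div_nonneg (bderiv_nonneg hβmono (ht.trans_lt hs')) (ht.trans_lt hs').le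
  unfold Edens; linarith

lemma Jfin {β : ℝ → ℝ} {βinf : ℝ} (hβ : ContDiff ℝ 1 β)
    (hβmono : StrictMonoOn β (Set.Ici 0))
    (hβlim : Tendsto β atTop (𝓝 βinf)) :
    ∫⁻ s in Ioi (0:ℝ), ENNReal.ofReal (deriv β s / s) * ENNReal.ofReal (√s) ≠ ⊤ := by
  rw [← Ioc_union_Ioi_eq_Ioi zero_le_one, lintegral_union measurableSet_Ioi
      (by rw [Set.disjoint_left]; intro x hx hx'; exact absurd hx.2 (not_le.2 hx'))]
  rw [ENNReal.add_ne_top]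
  constructor
  · obtain ⟨C, hC⟩ := (isCompact_Icc (a := (0:ℝ)) (b := 1)).exists_bound_of_continuousOn
      (hβ.continuous_deriv (by norm_num)).continuousOn
    have hi : IntegrableOn (fun s : ℝ => C * s ^ (-(1/2) : ℝ)) (Ioc 0 1) := by
      have := intervalIntegral.intervalIntegrable_rpow' (a := 0) (b := 1) (r := -(1/2))
        (by norm_num)
      rw [intervalIntegrable_iff_integrableOn_Ioc_of_le zero_le_one] at this
      exact this.const_mul C
    refine ne_top_of_le_ne_top hi.lintegral_lt_top.ne ?_
    apply setLIntegral_mono' measurableSet_Ioc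
    intro s hs
    have h1 := bderiv_nonneg hβmono hs.1
    rw [← ENNReal.ofReal_mul (div_nonneg h1 hs.1.le)]
    apply ENNReal.ofReal_le_ofReal
    have h2 := (le_abs_self _).trans (hC s ⟨hs.1.le, hs.2⟩)
    have h3 : s ^ (-(1/2) : ℝ) = √s / s := by
      rw [Real.rpow_neg hs.1.le, ← Real.sqrt_eq_rpow, Real.sqrt_div_self]
    rw [h3, div_mul_eq_mul_div, mul_div_assoc]
    have : 0 ≤ √s / s := div_nonneg (Real.sqrt_nonneg _) hs.1.le
    gcongr
  · refine ne_top_of_le_ne_top (bderiv_int hβ hβmono hβlim zero_le_one).lintegral_lt_top.ne ?_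
    apply setLIntegral_mono' measurableSet_Ioi
    intro s hs
    have hs1 : (1:ℝ) < s := hs
    have hs0 : (0:ℝ) < s := by linarith
    have h1 := bderiv_nonneg hβmono hs0
    rw [← ENNReal.ofReal_mul (div_nonneg h1 hs0.le)]
    apply ENNReal.ofReal_le_ofReal
    rw [div_mul_eq_mul_div, div_le_iff₀ hs0]
    have : √s ≤ s := by rw [Real.sqrt_le_left hs0.le]; nlinarith
    gcongr

lemma min_le_sqrt {s t : ℝ} (hs : 0 ≤ s) (ht : 0 ≤ t) : min s t ≤ √s * √t := by
  rw [← Real.sqrt_mul hs]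
  apply Real.le_sqrt_of_sq_le
  rcases le_total s t with h | h
  · rw [min_eq_left h]; nlinarith
  · rw [min_eq_right h]; nlinarith

lemma neg_mul_log_le {t : ℝ} (ht : 0 ≤ t) : -(t * Real.log t) ≤ 2 * √t := by
  rcases ht.eq_or_lt with rfl | ht
  · simp
  · have hq : 0 < √t := Real.sqrt_pos.2 ht
    have h := Real.one_sub_inv_le_log_of_pos hq
    rw [Real.log_sqrt ht.le] at h
    have h3 : t * (√t)⁻¹ = √t := by
      rw [← div_eq_mul_inv, Real.div_sqrt]
    nlinarith

lemma sqrt_bound {t x : ℝ} (ht : 0 ≤ t) : √t ≤ (1 + x ^ 2) * t + (1 + x ^ 2)⁻¹ := by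
  have hw : 0 < 1 + x ^ 2 := by positivity
  have h : (1 + x^2) * (1 + x ^ 2)⁻¹ = 1 := mul_inv_cancel₀ hw.ne'
  apply Real.sqrt_le_iff.2
  have hi : 0 < (1 + x ^ 2)⁻¹ := by positivity
  generalize (1 + x ^ 2)⁻¹ = i at *
  generalize (1 + x ^ 2) = w at *
  constructor
  · positivity
  · have h1 : (w * t + i) ^ 2 = (w*t)^2 + i^2 + 2 * t * (w * i) := by ring
    rw [h1, h]
    nlinarith [sq_nonneg (w*t), sq_nonneg i]

lemma lsqrt_bound {u : ℝ → ℝ} (hu : Measurable u) (h0 : ∀ x, 0 ≤ u x) {m : ℝ} {M : ℝ≥0∞}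
    (hm : (volume.withDensity fun x => ENNReal.ofReal (u x)) Set.univ = ENNReal.ofReal m)
    (hM : ∫⁻ x, ENNReal.ofReal (x ^ 2) ∂(volume.withDensity fun y => ENNReal.ofReal (u y)) ≤ M) :
    ∫⁻ x, ENNReal.ofReal (√(u x)) ≤
      (ENNReal.ofReal m + M) + ∫⁻ x : ℝ, ENNReal.ofReal ((1 + x ^ 2)⁻¹) := by
  have hu' : Measurable fun y => ENNReal.ofReal (u y) := hu.ennreal_ofReal
  calc ∫⁻ x, ENNReal.ofReal (√(u x))
      ≤ ∫⁻ x, ((ENNReal.ofReal (u x) + ENNReal.ofReal (u x) * ENNReal.ofReal (x ^ 2)) +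
          ENNReal.ofReal ((1 + x ^ 2)⁻¹)) := by
        apply lintegral_mono
        intro x
        simp only
        rw [← ENNReal.ofReal_mul (h0 x), ← ENNReal.ofReal_add (h0 x)
          (mul_nonneg (h0 x) (sq_nonneg x)), ← ENNReal.ofReal_add]
        · apply ENNReal.ofReal_le_ofReal
          have := sqrt_bound (x := x) (h0 x)
          linarith
        · have := h0 x; positivity
        · positivity
    _ ≤ _ := by
        rw [lintegral_add_right _ (by fun_prop), lintegral_add_left hu']
        gcongr
        · rw [← hm, withDensity_apply _ MeasurableSet.univ]; simp
        · rw [lintegral_withDensity_eq_lintegral_mul _ hu' (by fun_prop)] at hM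
          exact hM

lemma level_set_bound (ρ : Measure ℝ) [IsFiniteMeasure ρ] {s : ℝ} (hs : 0 < s) :
    ∃ B : Set ℝ, MeasurableSet B ∧ volume Bᶜ ≠ ⊤ ∧
      ENNReal.ofReal s * volume Bᶜ + ρ B ≤
        ∫⁻ x, ENNReal.ofReal (min s (ρ.rnDeriv volume x).toReal) := by
  set f := ρ.rnDeriv volume with hf
  have hfm : Measurable f := Measure.measurable_rnDeriv _ _
  obtain ⟨T, hT, hT1, hT2⟩ := Measure.mutuallySingular_singularPart ρ (volume : Measure ℝ)
  have hB : MeasurableSet ({x | f x < ENNReal.ofReal s} ∩ T) :=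
    (measurableSet_lt hfm measurable_const).inter hT
  have hc0 : ENNReal.ofReal s ≠ 0 := by simpa using hs
  have hfin : ∫⁻ x, f x ≠ ⊤ := (Measure.lintegral_rnDeriv_lt_top ρ volume).ne
  refine ⟨{x | f x < ENNReal.ofReal s} ∩ T, hB, ?_, ?_⟩
  · have h1 := mul_meas_ge_le_lintegral₀ (μ := volume) hfm.aemeasurable (ENNReal.ofReal s)
    have h2 : volume {x | ENNReal.ofReal s ≤ f x} ≠ ⊤ := by
      intro h
      rw [h, ENNReal.mul_top hc0] at h1
      exact hfin (top_le_iff.1 h1)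
    refine ne_top_of_le_ne_top (b := volume {x | ENNReal.ofReal s ≤ f x} + volume Tᶜ) ?_ ?_
    · rw [hT2, add_zero]; exact h2
    · refine le_trans (measure_mono ?_) (measure_union_le _ _)
      intro x hx
      by_cases hxT : x ∈ T
      · left
        by_contra h
        exact hx ⟨by simpa using h, hxT⟩
      · right; exact hxT
  · set B := {x | f x < ENNReal.ofReal s} ∩ T with hBdef
    rw [← lintegral_add_compl _ hB, add_comm]
    have hTae : ∀ᵐ x ∂(volume : Measure ℝ), x ∈ T := by
      rw [ae_iff]; exact hT2
    have hlt : ∀ᵐ x ∂(volume : Measure ℝ), f x < ⊤ := Measure.rnDeriv_lt_top ρ volume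
    gcongr
    · have h3 : ρ B = ∫⁻ x in B, f x := by
        conv_lhs => rw [Measure.haveLebesgueDecomposition_add ρ (volume : Measure ℝ)]
        rw [Measure.add_apply, withDensity_apply _ hB,
          measure_mono_null (show B ⊆ T from inter_subset_right) hT1, zero_add]
      rw [h3]
      apply lintegral_mono_ae
      filter_upwards [ae_restrict_mem hB, ae_restrict_of_ae hlt] with x hx hx2
      have h4 : (f x).toReal ≤ s := by
        have := (ENNReal.toReal_lt_toReal hx2.ne ENNReal.ofReal_ne_top).2 hx.1
        rw [ENNReal.toReal_ofReal hs.le] at this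
        exact this.le
      rw [min_eq_right h4, ENNReal.ofReal_toReal hx2.ne]
    · rw [← setLIntegral_const]
      apply lintegral_mono_ae
      filter_upwards [ae_restrict_mem hB.compl, ae_restrict_of_ae hlt, ae_restrict_of_ae hTae]
        with x hx hx2 hx3
      have h4 : s ≤ (f x).toReal := by
        have h5 : ENNReal.ofReal s ≤ f x := by
          by_contra h
          exact hx ⟨not_le.1 h, hx3⟩
        exact (ENNReal.ofReal_le_iff_le_toReal hx2.ne).1 h5
      rw [min_eq_left h4]

lemma level_limsup (ρ : Measure ℝ) [IsFiniteMeasure ρ] {s : ℝ} (hs : 0 < s)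
    (un : ℕ → ℝ → ℝ) (hun : ∀ n, Measurable (un n)) (hunn : ∀ n, ∀ x : ℝ, 0 ≤ un n x)
    {m : ℝ}
    (hmassn : ∀ n, (volume.withDensity fun x => ENNReal.ofReal (un n x)) Set.univ
      = ENNReal.ofReal m)
    (hconv : ∀ φ : ℝ → ℝ, Continuous φ → (∃ C : ℝ, ∀ x : ℝ, |φ x| ≤ C) →
      Tendsto (fun n => ∫ x, φ x ∂(volume.withDensity fun y => ENNReal.ofReal (un n y)))
        atTop (𝓝 (∫ x, φ x ∂ρ))) :
    limsup (fun n => ∫⁻ x, ENNReal.ofReal (min s (un n x))) atTop ≤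
      ∫⁻ x, ENNReal.ofReal (min s (ρ.rnDeriv volume x).toReal) := by
  have hfinn : ∀ n, IsFiniteMeasure (volume.withDensity fun x => ENNReal.ofReal (un n x)) :=
    fun n => ⟨by rw [hmassn n]; simp⟩
  obtain ⟨B, hB, hBf, hBle⟩ := level_set_bound ρ hs
  refine le_trans ?_ hBle
  apply ENNReal.le_of_forall_pos_le_add
  intro ε hε _
  have hε' : 0 < (ε:ℝ) / (s + 2) := by positivity
  have hind : Integrable (indicator Bᶜ (fun _ => (1:ℝ))) (volume + ρ) := by
    rw [integrable_indicator_iff hB.compl]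
    apply integrableOn_const
    · rw [Measure.add_apply]
      exact ENNReal.add_ne_top.2 ⟨hBf, measure_ne_top _ _⟩
    · simp
  have : IsFiniteMeasureOnCompacts (volume + ρ) := ⟨fun K hK => by
    rw [Measure.add_apply]
    exact ENNReal.add_lt_top.2 ⟨hK.measure_lt_top, measure_lt_top _ _⟩⟩
  obtain ⟨g, hgc, hgi, hgcont, hgint⟩ := hind.exists_hasCompactSupport_integral_sub_le hε'
  set ψ : ℝ → ℝ := fun x => max 0 (min 1 (g x)) with hψ
  have hψcont : Continuous ψ := by fun_prop
  have hψ0 : ∀ x, 0 ≤ ψ x := fun x => le_max_left _ _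
  have hψ1 : ∀ x, ψ x ≤ 1 := fun x => max_le zero_le_one (min_le_left _ _)
  have hψc : HasCompactSupport ψ := by
    have : ψ = (fun y => max 0 (min 1 y)) ∘ g := rfl
    rw [this]
    exact hgc.comp_left (by simp)
  have hψint : Integrable ψ (volume + ρ) := hψcont.integrable_of_hasCompactSupport hψc
  set χ := indicator Bᶜ (fun _ => (1:ℝ)) with hχ
  have hχ01 : ∀ x, χ x = 0 ∨ χ x = 1 := by
    intro x
    by_cases hx : x ∈ Bᶜ
    · right; simp only [hχ, indicator_of_mem hx]
    · left; simp only [hχ, indicator_of_notMem hx]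
  have hcl : ∀ x, |χ x - ψ x| ≤ |χ x - g x| := by
    intro x
    simp only [hψ]
    rcases hχ01 x with h | h <;> rw [h] <;>
    rcases le_total 1 (g x) with h1 | h1 <;> rcases le_total 0 (g x) with h2 | h2 <;>
    simp [h1, h2, abs_of_nonneg, abs_of_nonpos, sub_nonneg] <;> linarith
  have hψi : ∫ x, |χ x - ψ x| ∂(volume + ρ) ≤ (ε:ℝ) / (s + 2) := by
    refine le_trans (integral_mono (hind.sub hψint).abs (hind.sub hgint).abs hcl) hgi
  have hd : Integrable (fun x => |χ x - ψ x|) (volume + ρ) := (hind.sub hψint).abs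
  rw [integral_add_measure hd.left_of_add_measure hd.right_of_add_measure] at hψi
  have hp1 : 0 ≤ ∫ x, |χ x - ψ x| := integral_nonneg fun x => abs_nonneg _
  have hp2 : 0 ≤ ∫ x, |χ x - ψ x| ∂ρ := integral_nonneg fun x => abs_nonneg _
  have q1 : ∫ x, ψ x ≤ (volume Bᶜ).toReal + ∫ x, |χ x - ψ x| := by
    have : (volume Bᶜ).toReal = ∫ x, χ x := by
      rw [hχ, integral_indicator_const _ hB.compl]; simp [Measure.real]
    rw [this, ← integral_add hind.left_of_add_measure hd.left_of_add_measure]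
    apply integral_mono hψint.left_of_add_measure
      (hind.left_of_add_measure.add hd.left_of_add_measure)
    intro x
    have := neg_abs_le (χ x - ψ x)
    simp only [Pi.add_apply]; linarith
  have hψρ : Integrable (fun x => 1 - ψ x) ρ :=
    (integrable_const 1).sub hψint.right_of_add_measure
  have q2 : ∫ x, (1 - ψ x) ∂ρ ≤ (ρ B).toReal + ∫ x, |χ x - ψ x| ∂ρ := by
    have : (ρ B).toReal = ∫ x, (1 - χ x) ∂ρ := by
      have e : (fun x => 1 - χ x) = indicator B (fun _ => (1:ℝ)) := by
        ext x
        by_cases hx : x ∈ B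
        · simp [hχ, hx]
        · simp [hχ, hx]
      rw [e, integral_indicator_const _ hB]; simp [Measure.real]
    have hi1 : Integrable (fun x => 1 - χ x) ρ :=
      (integrable_const 1).sub hind.right_of_add_measure
    rw [this, ← integral_add hi1 hd.right_of_add_measure]
    apply integral_mono hψρ (hi1.add hd.right_of_add_measure)
    intro x
    have := le_abs_self (χ x - ψ x)
    simp only [Pi.add_apply]; linarith
  have hlim := hconv (fun x => 1 - ψ x) (by fun_prop) ⟨1, fun x => by
    rw [abs_le]; constructor <;> linarith [hψ0 x, hψ1 x]⟩
  have hup : ∀ n, ∫⁻ x, ENNReal.ofReal (min s (un n x)) ≤ ENNReal.ofReal (s * (∫ x, ψ x) +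
      ∫ x, (1 - ψ x) ∂(volume.withDensity fun y => ENNReal.ofReal (un n y))) := by
    intro n
    have hu' : Measurable fun y => ENNReal.ofReal (un n y) := (hun n).ennreal_ofReal
    have := hfinn n
    rw [ENNReal.ofReal_add (mul_nonneg hs.le (integral_nonneg hψ0))
      (integral_nonneg fun x => sub_nonneg.2 (hψ1 x)), ENNReal.ofReal_mul hs.le,
      ofReal_integral_eq_lintegral_ofReal hψint.left_of_add_measure (ae_of_all _ hψ0),
      ofReal_integral_eq_lintegral_ofReal _ (ae_of_all _ fun x => sub_nonneg.2 (hψ1 x)),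
      lintegral_withDensity_eq_lintegral_mul _ hu' (by fun_prop), ← lintegral_const_mul _ (by fun_prop),
      ← lintegral_add_left (by fun_prop)]
    · apply lintegral_mono
      intro x
      simp only [Pi.mul_apply]
      rw [← ENNReal.ofReal_mul hs.le, ← ENNReal.ofReal_mul (hunn n x), ← ENNReal.ofReal_add
        (mul_nonneg hs.le (hψ0 x)) (mul_nonneg (hunn n x) (sub_nonneg.2 (hψ1 x)))]
      apply ENNReal.ofReal_le_ofReal
      have a1 := min_le_left s (un n x)
      have a2 := min_le_right s (un n x)
      nlinarith [hψ0 x, hψ1 x]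
    · exact Integrable.of_bound (by fun_prop) 1 (ae_of_all _ fun x => by
        rw [Real.norm_eq_abs, abs_le]; constructor <;> linarith [hψ0 x, hψ1 x])
  have htend : Tendsto (fun n => ENNReal.ofReal (s * (∫ x, ψ x) +
      ∫ x, (1 - ψ x) ∂(volume.withDensity fun y => ENNReal.ofReal (un n y)))) atTop
      (𝓝 (ENNReal.ofReal (s * (∫ x, ψ x) + ∫ x, (1 - ψ x) ∂ρ))) :=
    ENNReal.tendsto_ofReal (hlim.const_add _)
  refine (limsup_le_limsup (Eventually.of_forall hup)).trans ?_
  rw [htend.limsup_eq]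
  have hfinal : s * (∫ x, ψ x) + ∫ x, (1 - ψ x) ∂ρ ≤
      s * (volume Bᶜ).toReal + (ρ B).toReal + ε := by
    have hε2 : (s + 2) * ((ε:ℝ) / (s + 2)) = ε := by field_simp
    nlinarith [ENNReal.toReal_nonneg (a := volume Bᶜ), ENNReal.toReal_nonneg (a := ρ B)]
  refine (ENNReal.ofReal_le_ofReal hfinal).trans ?_
  rw [ENNReal.ofReal_add (by positivity) (by positivity), ENNReal.ofReal_add (by positivity) (by positivity),
    ENNReal.ofReal_mul hs.le, ENNReal.ofReal_toReal hBf, ENNReal.ofReal_toReal (measure_ne_top _ _)]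
  simp

lemma E_limsup {β : ℝ → ℝ} {βinf : ℝ} (hβ : ContDiff ℝ 1 β)
    (hβmono : StrictMonoOn β (Set.Ici 0)) (hβ0 : β 0 = 0)
    (hβlim : Tendsto β atTop (𝓝 βinf))
    (ρ : Measure ℝ) [IsFiniteMeasure ρ]
    (un : ℕ → ℝ → ℝ) (hun : ∀ n, Measurable (un n)) (hunn : ∀ n, ∀ x : ℝ, 0 ≤ un n x)
    {m : ℝ}
    (hmassn : ∀ n, (volume.withDensity fun x => ENNReal.ofReal (un n x)) Set.univ
      = ENNReal.ofReal m)
    (hconv : ∀ φ : ℝ → ℝ, Continuous φ → (∃ C : ℝ, ∀ x : ℝ, |φ x| ≤ C) →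
      Tendsto (fun n => ∫ x, φ x ∂(volume.withDensity fun y => ENNReal.ofReal (un n y)))
        atTop (𝓝 (∫ x, φ x ∂ρ)))
    {C : ℝ≥0∞} (hC : C ≠ ⊤) (hsq : ∀ n, ∫⁻ x, ENNReal.ofReal (√(un n x)) ≤ C) :
    limsup (fun n => ∫⁻ x, ENNReal.ofReal (-(Edens β (un n x)))) atTop ≤
      ∫⁻ x, ENNReal.ofReal (-(Edens β (ρ.rnDeriv volume x).toReal)) := by
  have key : ∀ v : ℝ → ℝ, Measurable v → (∀ x, 0 ≤ v x) →
      ∫⁻ x, ENNReal.ofReal (-(Edens β (v x))) =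
      ∫⁻ s in Ioi (0:ℝ), ENNReal.ofReal (deriv β s / s) * ∫⁻ x, ENNReal.ofReal (min s (v x)) := by
    intro v hv hv0
    have hd : Measurable (deriv β) := measurable_deriv β
    simp_rw [fun x => Fform hβ hβmono hβ0 hβlim (hv0 x)]
    rw [lintegral_lintegral_swap]
    · apply lintegral_congr
      intro s
      rw [lintegral_const_mul]
      fun_prop
    · apply Measurable.aemeasurable
      unfold Function.uncurry
      fun_prop
  simp_rw [fun n => key (un n) (hun n) (hunn n)]
  rw [key _ (Measure.measurable_rnDeriv _ _).ennreal_toReal (fun x => ENNReal.toReal_nonneg)]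
  have hd : Measurable (deriv β) := measurable_deriv β
  refine (limsup_lintegral_le
    (fun s => ENNReal.ofReal (deriv β s / s) * ENNReal.ofReal (√s) * C) ?_ ?_ ?_).trans ?_
  · intro n
    apply Measurable.mul (by fun_prop)
    apply Measurable.lintegral_prod_right
    have := hun n
    fun_prop
  · intro n
    filter_upwards [ae_restrict_mem measurableSet_Ioi] with s hs
    rw [mul_assoc]
    gcongr
    refine le_trans ?_ (mul_le_mul_right (hsq n) _)
    rw [← lintegral_const_mul _ (by have := hun n; fun_prop)]
    apply lintegral_mono
    intro x
    simp only
    rw [← ENNReal.ofReal_mul (Real.sqrt_nonneg _)]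
    exact ENNReal.ofReal_le_ofReal (min_le_sqrt (le_of_lt hs) (hunn n x))
  · rw [lintegral_mul_const _ (by fun_prop)]
    exact ENNReal.mul_ne_top (Jfin hβ hβmono hβlim) hC
  · apply setLIntegral_mono' measurableSet_Ioi
    intro s hs
    rw [ENNReal.limsup_const_mul_of_ne_top ENNReal.ofReal_ne_top]
    gcongr
    exact level_limsup ρ hs un hun hunn hmassn hconv

lemma erealInt_of_integrable {f : ℝ → ℝ} {μ : Measure ℝ} (hf : Integrable f μ) :
    erealInt f μ = ((∫ x, f x ∂μ : ℝ) : EReal) := by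
  rw [integral_eq_lintegral_pos_part_sub_lintegral_neg_part hf, erealInt, EReal.coe_sub,
    EReal.coe_ennreal_toReal hf.lintegral_lt_top.ne,
    EReal.coe_ennreal_toReal (show (∫⁻ x, ENNReal.ofReal (-(f x)) ∂μ) ≠ ⊤ from
      hf.neg.lintegral_lt_top.ne)]

lemma erealInt_mono {f g : ℝ → ℝ} {μ : Measure ℝ} (h : ∀ x, g x ≤ f x) :
    erealInt g μ ≤ erealInt f μ := by
  unfold erealInt
  apply EReal.sub_le_sub
  · exact EReal.coe_ennreal_le_coe_ennreal_iff.2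
      (lintegral_mono fun x => ENNReal.ofReal_le_ofReal (h x))
  · exact EReal.coe_ennreal_le_coe_ennreal_iff.2
      (lintegral_mono fun x => ENNReal.ofReal_le_ofReal (neg_le_neg (h x)))

lemma V_liminf (V : ℝ → ℝ) (hV : Continuous V) (Vn : ℕ → ℝ → ℝ)
    (hVnconv : ∀ K : Set ℝ, IsCompact K → TendstoUniformlyOn (fun n => Vn n) V atTop K)
    (hVnquad : ∀ δ : ℝ, 0 < δ → ∃ R : ℝ, 0 < R ∧ ∀ n, ∀ x : ℝ, R ≤ |x| → -δ * x ^ 2 ≤ Vn n x)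
    (ρ : Measure ℝ) [IsFiniteMeasure ρ] (ν : ℕ → Measure ℝ) [∀ n, IsFiniteMeasure (ν n)]
    (m : ℝ) (hm : 0 < m) (hmassn : ∀ n, ν n Set.univ = ENNReal.ofReal m)
    (hconv : ∀ φ : ℝ → ℝ, Continuous φ → (∃ C : ℝ, ∀ x : ℝ, |φ x| ≤ C) →
      Tendsto (fun n => ∫ x, φ x ∂(ν n)) atTop (𝓝 (∫ x, φ x ∂ρ)))
    (M : ℝ≥0∞) (hM : M ≠ ⊤) (hmom : ∀ n, ∫⁻ x, ENNReal.ofReal (x ^ 2) ∂(ν n) ≤ M) :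
    erealInt V ρ ≤ liminf (fun n => erealInt (Vn n) (ν n)) atTop := by
  rw [← EReal.ge_of_forall_gt_iff_ge]
  intro a ha
  obtain ⟨a', haa', ha'⟩ := EReal.lt_iff_exists_real_btwn.1 ha
  have haa : a < a' := EReal.coe_lt_coe_iff.1 haa'
  set N := ∫⁻ x, ENNReal.ofReal (-(V x)) ∂ρ with hN
  set P := ∫⁻ x, ENNReal.ofReal (V x) ∂ρ with hP
  have hVe : erealInt V ρ = (P : EReal) - (N : EReal) := rfl
  rw [hVe] at ha'
  have hNtop : N ≠ ⊤ := by
    intro h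
    rw [h] at ha'
    simp at ha'
  have hNr : (N : EReal) = ((N.toReal : ℝ) : EReal) := (EReal.coe_ennreal_toReal hNtop).symm
  set χ : ℕ → ℝ → ℝ := fun k x => max 0 (min 1 ((k:ℝ) + 1 - |x|)) with hχ
  have hχc : ∀ k, Continuous (χ k) := fun k => by simp only [hχ]; fun_prop
  have hχ0 : ∀ k x, 0 ≤ χ k x := fun k x => le_max_left _ _
  have hχ1 : ∀ k x, χ k x ≤ 1 := fun k x => max_le zero_le_one (min_le_left _ _)
  have hχin : ∀ (k : ℕ) (x : ℝ), |x| ≤ k → χ k x = 1 := fun k x h => by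
    simp only [hχ]
    rw [min_eq_left (by linarith), max_eq_right zero_le_one]
  have hχout : ∀ (k : ℕ) x, (k:ℝ) + 1 ≤ |x| → χ k x = 0 := fun k x h => by
    simp only [hχ]
    exact max_eq_left ((min_le_right _ _).trans (by linarith))
  have hcutb : ∀ k, ∃ C, ∀ x, |χ k x * V x| ≤ C := by
    intro k
    obtain ⟨C, hC⟩ := (isCompact_Icc (a := -((k:ℝ) + 1)) (b := k + 1)).exists_bound_of_continuousOn
      hV.continuousOn
    refine ⟨max C 0, fun x => ?_⟩
    by_cases hx : |x| ≤ k + 1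
    · have := hC x (abs_le.1 hx)
      rw [abs_mul, abs_of_nonneg (hχ0 k x)]
      rw [Real.norm_eq_abs] at this
      refine le_trans ?_ (le_max_left _ _)
      nlinarith [hχ0 k x, hχ1 k x, abs_nonneg (V x)]
    · rw [hχout k x (not_le.1 hx).le]; simp
  have hcutc : ∀ k, Continuous (fun x => χ k x * V x) := fun k => (hχc k).mul hV
  have hcuti : ∀ k (μ : Measure ℝ) [IsFiniteMeasure μ], Integrable (fun x => χ k x * V x) μ := by
    intro k μ _
    obtain ⟨C, hC⟩ := hcutb k
    exact Integrable.of_bound (hcutc k).aestronglyMeasurable C (ae_of_all _ hC)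
  have hmonoC : Tendsto (fun k : ℕ => ∫⁻ x, ENNReal.ofReal (χ k x) * ENNReal.ofReal (V x) ∂ρ)
      atTop (𝓝 P) := by
    apply lintegral_tendsto_of_tendsto_of_monotone
    · intro k
      have h1 := (hχc k).measurable
      have h2 := hV.measurable
      fun_prop
    · refine ae_of_all _ fun x => ?_
      intro k l hkl
      have : (k:ℝ) ≤ l := by exact_mod_cast hkl
      simp only [hχ]
      gcongr
    · refine ae_of_all _ fun x => ?_
      obtain ⟨k0, hk0⟩ := exists_nat_ge |x|
      apply tendsto_const_nhds.congr'
      filter_upwards [eventually_ge_atTop k0] with k hk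
      have : (k0:ℝ) ≤ k := by exact_mod_cast hk
      rw [hχin k x (hk0.trans this)]; simp
  have hlt : ((a' + N.toReal : ℝ) : EReal) < P := by
    rw [hNr] at ha'
    have := (EReal.lt_sub_iff_add_lt (Or.inl (EReal.coe_ne_bot _))
      (Or.inl (EReal.coe_ne_top _))).1 ha'
    rwa [EReal.coe_add]
  have hmonoE := (EReal.tendsto_coe_ennreal.2 hmonoC).eventually (lt_mem_nhds hlt)
  set γ := a' - a with hγ
  have hγ0 : 0 < γ := sub_pos.2 haa
  have hMr : 0 ≤ M.toReal := ENNReal.toReal_nonneg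
  set δ := γ / (2 * (M.toReal + 1)) with hδ
  set η := γ / (2 * (m + 1)) with hη
  have hδ0 : 0 < δ := by positivity
  have hη0 : 0 < η := by positivity
  have hδM : δ * M.toReal ≤ γ / 2 := by
    rw [hδ, div_mul_eq_mul_div, div_le_div_iff₀ (by positivity) (by positivity)]
    nlinarith
  have hηm : η * m ≤ γ / 2 := by
    rw [hη, div_mul_eq_mul_div, div_le_div_iff₀ (by positivity) (by positivity)]
    nlinarith
  obtain ⟨R, hR0, hR⟩ := hVnquad δ hδ0
  obtain ⟨k0, hk0⟩ := exists_nat_ge R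
  obtain ⟨k, hk1, hk2⟩ := (hmonoE.and (eventually_ge_atTop k0)).exists
  have hkR : R ≤ k := hk0.trans (by exact_mod_cast hk2)
  have hcut : a' < ∫ x, χ k x * V x ∂ρ := by
    rw [← EReal.coe_lt_coe_iff, ← erealInt_of_integrable (hcuti k ρ)]
    have h1 : (a' : EReal) < (∫⁻ x, ENNReal.ofReal (χ k x) * ENNReal.ofReal (V x) ∂ρ : ℝ≥0∞)
        - (N : EReal) := by
      rw [hNr, EReal.lt_sub_iff_add_lt (Or.inl (EReal.coe_ne_bot _))
        (Or.inl (EReal.coe_ne_top _)), ← EReal.coe_add]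
      exact hk1
    refine h1.trans_le ?_
    unfold erealInt
    apply EReal.sub_le_sub
    · apply EReal.coe_ennreal_le_coe_ennreal_iff.2
      apply lintegral_mono
      intro x
      simp only
      rw [ENNReal.ofReal_mul (hχ0 k x)]
    · apply EReal.coe_ennreal_le_coe_ennreal_iff.2
      apply lintegral_mono
      intro x
      simp only
      rw [← mul_neg, ENNReal.ofReal_mul (hχ0 k x)]
      calc _ ≤ 1 * ENNReal.ofReal (-V x) := by
            gcongr
            exact ENNReal.ofReal_le_one.2 (hχ1 k x)
        _ = _ := one_mul _
  have hev1 := (hconv _ (hcutc k) (hcutb k)).eventually (lt_mem_nhds hcut)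
  have hev2 := (Metric.tendstoUniformlyOn_iff.1
    (hVnconv (Icc (-((k:ℝ)+1)) (k+1)) isCompact_Icc)) η hη0
  apply le_liminf_of_le
  · isBoundedDefault
  filter_upwards [hev1, hev2] with n h1 h2
  have hpt : ∀ x, χ k x * V x - η - δ * x ^ 2 ≤ Vn n x := by
    intro x
    by_cases hx : |x| ≤ k + 1
    · have h3 := h2 x (abs_le.1 hx)
      rw [Real.dist_eq, abs_lt] at h3
      by_cases hx2 : |x| ≤ k
      · rw [hχin k x hx2]
        have : 0 ≤ δ * x ^ 2 := by positivity
        linarith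
      · have h4 := hR n x (hkR.trans (not_le.1 hx2).le)
        have : 0 ≤ δ * x ^ 2 := by positivity
        nlinarith [hχ0 k x, hχ1 k x]
    · rw [hχout k x (not_le.1 hx).le]
      have h4 := hR n x (by linarith [not_le.1 hx])
      linarith
  have hx2i : Integrable (fun x : ℝ => x ^ 2) (ν n) := by
    refine ⟨by fun_prop, ?_⟩
    rw [hasFiniteIntegral_iff_ofReal (ae_of_all _ fun x => sq_nonneg x)]
    exact (hmom n).trans_lt hM.lt_top
  have hx2 : ∫ x, x ^ 2 ∂(ν n) ≤ M.toReal := by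
    rw [integral_eq_lintegral_of_nonneg_ae (ae_of_all _ fun x => sq_nonneg x) (by fun_prop)]
    exact ENNReal.toReal_mono hM (hmom n)
  have hint1 : Integrable (fun x => χ k x * V x - η) (ν n) :=
    (hcuti k (ν n)).sub (integrable_const η)
  have hint : Integrable (fun x => χ k x * V x - η - δ * x ^ 2) (ν n) :=
    hint1.sub (hx2i.const_mul δ)
  refine le_trans ?_ (erealInt_mono hpt)
  rw [erealInt_of_integrable hint, EReal.coe_le_coe_iff,
    integral_sub hint1 (hx2i.const_mul δ), integral_sub (hcuti k (ν n)) (integrable_const η),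
    integral_const, integral_const_mul, Measure.real, hmassn n, ENNReal.toReal_ofReal hm.le,
    smul_eq_mul]
  have : δ * ∫ x, x ^ 2 ∂(ν n) ≤ δ * M.toReal := by gcongr
  linarith

lemma gamma_aux
    (β V : ℝ → ℝ) (βinf : ℝ)
    (hβ : ContDiff ℝ 1 β) (hβmono : StrictMonoOn β (Set.Ici 0)) (hβ0 : β 0 = 0)
    (hβlim : Tendsto β atTop (𝓝 βinf))
    (hV : Continuous V)
    (Vn : ℕ → ℝ → ℝ)
    (hVnconv : ∀ K : Set ℝ, IsCompact K → TendstoUniformlyOn (fun n => Vn n) V atTop K)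
    (hVnquad : ∀ δ : ℝ, 0 < δ → ∃ R : ℝ, 0 < R ∧ ∀ n, ∀ x : ℝ, R ≤ |x| → -δ * x ^ 2 ≤ Vn n x)
    (εn : ℕ → ℝ) (hεpos : ∀ n, 0 < εn n)
    (hεlim : Tendsto εn atTop (𝓝 0))
    (m : ℝ) (hm : 0 < m)
    (un : ℕ → ℝ → ℝ) (hun : ∀ n, Measurable (un n)) (hunn : ∀ n, ∀ x : ℝ, 0 ≤ un n x)
    (ρ : Measure ℝ) [IsFiniteMeasure ρ]
    (hmassn : ∀ n, (volume.withDensity fun x => ENNReal.ofReal (un n x)) Set.univ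
      = ENNReal.ofReal m)
    (hconv : ∀ φ : ℝ → ℝ, Continuous φ → (∃ C : ℝ, ∀ x : ℝ, |φ x| ≤ C) →
      Tendsto (fun n => ∫ x, φ x ∂(volume.withDensity fun y => ENNReal.ofReal (un n y)))
        atTop (𝓝 (∫ x, φ x ∂ρ)))
    (M : ℝ≥0∞) (hM : M ≠ ⊤)
    (hmom : ∀ n, ∫⁻ x, ENNReal.ofReal (x ^ 2)
        ∂(volume.withDensity fun y => ENNReal.ofReal (un n y)) ≤ M) :
    erealInt (fun x => Edens β ((ρ.rnDeriv volume x).toReal)) volume + erealInt V ρ ≤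
      Filter.liminf
        (fun n =>
          erealInt (fun x => Edens β (un n x)) volume
            + ((εn n : ℝ) : EReal) * erealInt (fun x => un n x * Real.log (un n x)) volume
            + erealInt (Vn n) (volume.withDensity fun y => ENNReal.ofReal (un n y)))
        atTop := by
  have hfinn : ∀ n, IsFiniteMeasure (volume.withDensity fun x => ENNReal.ofReal (un n x)) :=
    fun n => ⟨by rw [hmassn n]; simp⟩
  set C : ℝ≥0∞ := (ENNReal.ofReal m + M) + ∫⁻ x : ℝ, ENNReal.ofReal ((1 + x ^ 2)⁻¹) with hCdef
  have hC : C ≠ ⊤ := by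
    refine ENNReal.add_ne_top.2 ⟨ENNReal.add_ne_top.2 ⟨ENNReal.ofReal_ne_top, hM⟩, ?_⟩
    exact integrable_inv_one_add_sq.lintegral_lt_top.ne
  have hsq : ∀ n, ∫⁻ x, ENNReal.ofReal (√(un n x)) ≤ C := fun n =>
    lsqrt_bound (hun n) (hunn n) (hmassn n) (hmom n)
  have hE : ∀ v : ℝ → ℝ, (∀ x, 0 ≤ v x) → erealInt (fun x => Edens β (v x)) volume =
      -((∫⁻ x, ENNReal.ofReal (-(Edens β (v x))) : ℝ≥0∞) : EReal) := by
    intro v hv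
    have : ∀ x, ENNReal.ofReal (Edens β (v x)) = 0 := fun x =>
      ENNReal.ofReal_of_nonpos (Edens_nonpos hβmono hβ0 (hv x))
    simp [erealInt, this]
  have h1 : erealInt (fun x => Edens β ((ρ.rnDeriv volume x).toReal)) volume ≤
      liminf (fun n => erealInt (fun x => Edens β (un n x)) volume) atTop := by
    have hlim := E_limsup hβ hβmono hβ0 hβlim ρ un hun hunn hmassn hconv hC hsq
    rw [hE _ (fun x => ENNReal.toReal_nonneg)]
    simp_rw [fun n => hE (un n) (hunn n)]
    rw [show (fun n => -((∫⁻ x, ENNReal.ofReal (-(Edens β (un n x))) : ℝ≥0∞) : EReal)) =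
      -(fun n => ((∫⁻ x, ENNReal.ofReal (-(Edens β (un n x))) : ℝ≥0∞) : EReal)) from rfl,
      EReal.liminf_neg, EReal.neg_le_neg_iff]
    have hmap := Monotone.map_limsup_of_continuousAt (F := (atTop : Filter ℕ))
      (f := fun r : ℝ≥0∞ => (r : EReal)) (fun a b hab => EReal.coe_ennreal_le_coe_ennreal_iff.2 hab)
      (fun n => ∫⁻ x, ENNReal.ofReal (-(Edens β (un n x))))
      continuous_coe_ennreal_ereal.continuousAt
    have h5 := EReal.coe_ennreal_le_coe_ennreal_iff.2 hlim
    rw [hmap] at h5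
    exact h5
  have h2 : 0 ≤ liminf (fun n => ((εn n : ℝ) : EReal) *
      erealInt (fun x => un n x * Real.log (un n x)) volume) atTop := by
    have hlow : ∀ n, ((εn n * -(2 * C.toReal) : ℝ) : EReal) ≤ ((εn n : ℝ) : EReal) *
      erealInt (fun x => un n x * Real.log (un n x)) volume := by
      intro n
      rw [EReal.coe_mul]
      apply mul_le_mul_of_nonneg_left _ (by exact_mod_cast (hεpos n).le)
      have h6 : ∫⁻ x, ENNReal.ofReal (-(un n x * Real.log (un n x))) ≤ 2 * C := by
        refine le_trans ?_ (mul_le_mul_right (hsq n) 2)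
        rw [← lintegral_const_mul _ (by have := hun n; fun_prop)]
        apply lintegral_mono
        intro x
        have := ENNReal.ofReal_le_ofReal (neg_mul_log_le (hunn n x))
        rw [ENNReal.ofReal_mul zero_le_two] at this
        simpa using this
      have h7 : ((-(2 * C.toReal) : ℝ) : EReal) = 0 - ((2 * C : ℝ≥0∞) : EReal) := by
        rw [← EReal.coe_ennreal_toReal (ENNReal.mul_ne_top (by simp) hC)]
        simp [ENNReal.toReal_mul]
      rw [h7]
      unfold erealInt
      exact EReal.sub_le_sub (EReal.coe_ennreal_nonneg _)
        (EReal.coe_ennreal_le_coe_ennreal_iff.2 h6)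
    have ht : Tendsto (fun n => ((εn n * -(2 * C.toReal) : ℝ) : EReal)) atTop (𝓝 0) := by
      have := hεlim.mul_const (-(2 * C.toReal))
      rw [zero_mul] at this
      exact EReal.tendsto_coe.2 this
    rw [← ht.liminf_eq]
    exact liminf_le_liminf (Eventually.of_forall hlow)
  have h3 := V_liminf V hV Vn hVnconv hVnquad ρ
    (fun n => volume.withDensity fun y => ENNReal.ofReal (un n y)) m hm hmassn hconv M hM hmom
  calc _ ≤ liminf (fun n => erealInt (fun x => Edens β (un n x)) volume) atTop
        + liminf (fun n => ((εn n : ℝ) : EReal) *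
          erealInt (fun x => un n x * Real.log (un n x)) volume) atTop
        + liminf (fun n => erealInt (Vn n)
          (volume.withDensity fun y => ENNReal.ofReal (un n y))) atTop := by
        refine add_le_add ?_ h3
        have := add_le_add h1 h2
        rwa [add_zero] at this
    _ ≤ _ := (add_le_add_left EReal.le_liminf_add _).trans EReal.le_liminf_add

/-- Γ-liminf inequality for the regularized functionals
`F^ε(ρ) = ∫ E(u) dx + ε ∫ u log u dx + ∫ V^ε dρ` along a vanishing sequence `ε_n ↓ 0`,
absolutely continuous measures `ρ_n = u_n·ℒ¹` of mass `m` converging weakly to `ρ` in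
duality with bounded continuous functions, with uniformly bounded second moments. -/
theorem gamma_liminf_inequality
    (β V : ℝ → ℝ) (βinf lam : ℝ)
    (hβ : ContDiff ℝ 1 β) (hβmono : StrictMonoOn β (Set.Ici 0)) (hβ0 : β 0 = 0)
    (hβlim : Tendsto β atTop (𝓝 βinf))
    (hV : ContDiff ℝ 2 V) (hVpp : ∀ x : ℝ, lam ≤ deriv (deriv V) x)
    (hVquad : ∀ δ : ℝ, 0 < δ → ∃ R : ℝ, 0 < R ∧ ∀ x : ℝ, R ≤ |x| → -δ * x ^ 2 ≤ V x)
    -- the approximating potentials `V_n`: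
    (Vn : ℕ → ℝ → ℝ) (A : ℝ) (hA : 0 ≤ A)
    (hVnreg : ∀ n, ContDiff ℝ 2 (Vn n))
    (hVnupper : ∀ n, ∀ x : ℝ, Vn n x ≤ V x + A * x ^ 2)
    (hVnlow : ∀ n, ∀ x : ℝ, lam ≤ deriv (deriv (Vn n)) x)
    (hVnsup : ∀ n, ∀ x : ℝ, ∀ c : ℝ, (∀ y : ℝ, deriv (deriv V) y ≤ c) →
      deriv (deriv (Vn n)) x ≤ c)
    (hVnconv : ∀ K : Set ℝ, IsCompact K →
      TendstoUniformlyOn (fun n => Vn n) V atTop K ∧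
      TendstoUniformlyOn (fun n => deriv (Vn n)) (deriv V) atTop K ∧
      TendstoUniformlyOn (fun n => deriv (deriv (Vn n))) (deriv (deriv V)) atTop K)
    (hVnquad : ∀ δ : ℝ, 0 < δ → ∃ R : ℝ, 0 < R ∧ ∀ n, ∀ x : ℝ, R ≤ |x| → -δ * x ^ 2 ≤ Vn n x)
    -- the vanishing parameters `ε_n ↓ 0`:
    (εn : ℕ → ℝ) (hεpos : ∀ n, 0 < εn n) (hεanti : Antitone εn)
    (hεlim : Tendsto εn atTop (𝓝 0))
    -- the absolutely continuous measures `ρ_n = u_n·ℒ¹` and the limit `ρ`: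
    (m : ℝ) (hm : 0 < m)
    (un : ℕ → ℝ → ℝ) (hun : ∀ n, Measurable (un n)) (hunn : ∀ n, ∀ x : ℝ, 0 ≤ un n x)
    (ρ : Measure ℝ) (hρfin : IsFiniteMeasure ρ)
    (hmassn : ∀ n, (volume.withDensity fun x => ENNReal.ofReal (un n x)) Set.univ
      = ENNReal.ofReal m)
    (hmass : ρ Set.univ = ENNReal.ofReal m)
    (hconv : ∀ φ : ℝ → ℝ, Continuous φ → (∃ C : ℝ, ∀ x : ℝ, |φ x| ≤ C) →
      Tendsto (fun n => ∫ x, φ x ∂(volume.withDensity fun y => ENNReal.ofReal (un n y)))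
        atTop (𝓝 (∫ x, φ x ∂ρ)))
    (hmom : Filter.limsup
      (fun n => ∫⁻ x, ENNReal.ofReal (x ^ 2)
        ∂(volume.withDensity fun y => ENNReal.ofReal (un n y))) atTop < ⊤) :
    erealInt (fun x => Edens β ((ρ.rnDeriv volume x).toReal)) volume + erealInt V ρ ≤
      Filter.liminf
        (fun n =>
          erealInt (fun x => Edens β (un n x)) volume
            + ((εn n : ℝ) : EReal) * erealInt (fun x => un n x * Real.log (un n x)) volume
            + erealInt (Vn n) (volume.withDensity fun y => ENNReal.ofReal (un n y)))
        atTop := by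
  obtain ⟨M, hM1, hM2⟩ := exists_between hmom
  have hev := eventually_lt_of_limsup_lt hM1
  obtain ⟨N, hN⟩ := eventually_atTop.1 hev
  have hsh : Tendsto (fun n : ℕ => n + N) atTop atTop := tendsto_add_atTop_nat N
  have key := gamma_aux β V βinf hβ hβmono hβ0 hβlim hV.continuous (fun n => Vn (n + N))
    (fun K hK => by
      have h := (hVnconv K hK).1
      intro u hu
      exact hsh.eventually (h u hu))
    (fun δ hδ => by
      obtain ⟨R, hR, h⟩ := hVnquad δ hδ
      exact ⟨R, hR, fun n x hx => h (n + N) x hx⟩)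
    (fun n => εn (n + N)) (fun n => hεpos _) (hεlim.comp hsh) m hm (fun n => un (n + N))
    (fun n => hun _) (fun n => hunn _) ρ (fun n => hmassn _)
    (fun φ hφ hb => (hconv φ hφ hb).comp hsh) M hM2.ne
    (fun n => (hN (n + N) (Nat.le_add_left _ _)).le)
  refine key.trans (le_of_eq ?_)
  exact liminf_nat_add (fun n =>
          erealInt (fun x => Edens β (un n x)) volume
            + ((εn n : ℝ) : EReal) * erealInt (fun x => un n x * Real.log (un n x)) volume
            + erealInt (Vn n) (volume.withDensity fun y => ENNReal.ofReal (un n y))) N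
end

section
/- Logarithmic behavior of the energy density at zero: lim_{r→0⁺} E(r)/(r·log r) = β'(0). -/
open MeasureTheory Set Filter Topology

theorem aux_int (β : ℝ → ℝ) (βinf : ℝ)
    (hβ : ContDiff ℝ 1 β) (hβmono : StrictMonoOn β (Set.Ici 0))
    (hβlim : Tendsto β atTop (𝓝 βinf)) (r : ℝ) (hr : 0 < r) :
    IntegrableOn (fun s => deriv β s / s) (Set.Ioi r) := by
  have hd : Differentiable ℝ β := hβ.differentiable (by norm_num)
  have hc : Continuous (deriv β) := hβ.continuous_deriv (by norm_num)
  have hnn : ∀ x ∈ Set.Ioi r, 0 ≤ deriv β x := by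
    intro x hx
    have hx0 : x ∈ Set.Ioi (0:ℝ) := lt_trans hr hx
    have hm : MonotoneOn β (Set.Ioi 0) := hβmono.monotoneOn.mono Set.Ioi_subset_Ici_self
    rw [← derivWithin_of_isOpen isOpen_Ioi hx0]
    exact hm.derivWithin_nonneg
  have hi : IntegrableOn (deriv β) (Set.Ioi r) :=
    integrableOn_Ioi_deriv_of_nonneg hd.continuous.continuousWithinAt
      (fun x _ => (hd x).hasDerivAt) hnn hβlim
  have hi2 : IntegrableOn (fun s => deriv β s * r⁻¹) (Set.Ioi r) := hi.mul_const _
  refine Integrable.mono' hi2 ?_ ?_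
  · exact (hc.measurable.div measurable_id).aestronglyMeasurable
  · refine (ae_restrict_iff' measurableSet_Ioi).2 (Eventually.of_forall fun x hx => ?_)
    have hx' : r < x := hx
    have h1 := hnn x hx
    rw [Real.norm_of_nonneg (div_nonneg h1 (hr.trans hx').le), div_eq_mul_inv]
    gcongr

theorem energy_density_log_behavior_at_zero
    (β : ℝ → ℝ) (βinf : ℝ)
    (hβ : ContDiff ℝ 1 β) (hβmono : StrictMonoOn β (Set.Ici 0)) (hβ0 : β 0 = 0)
    (hβlim : Tendsto β atTop (𝓝 βinf)) :
    Tendsto (fun r => Edens β r / (r * Real.log r)) (𝓝[>] (0 : ℝ)) (𝓝 (deriv β 0)) := by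
  have hd : Differentiable ℝ β := hβ.differentiable (by norm_num)
  have hc : Continuous (deriv β) := hβ.continuous_deriv (by norm_num)
  have hlog : Tendsto Real.log (𝓝[>] (0:ℝ)) atBot := Real.tendsto_log_nhdsGT_zero
  have hinv : Tendsto (fun r => (Real.log r)⁻¹) (𝓝[>] (0:ℝ)) (𝓝 0) :=
    tendsto_inv_atBot_zero.comp hlog
  have hq : Tendsto (fun r => r⁻¹ * β r) (𝓝[>] (0:ℝ)) (𝓝 (deriv β 0)) := by
    have := (hd 0).hasDerivAt.tendsto_slope_zero_right
    simpa [hβ0] using this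
  set b := deriv β 0 with hb
  set G : ℝ → ℝ := fun r => ∫ s in Set.Ioi r, deriv β s / s with hG
  have key : Tendsto (fun r => (G r + b * Real.log r) * (Real.log r)⁻¹) (𝓝[>] (0:ℝ)) (𝓝 0) := by
    rw [Metric.tendsto_nhds]
    intro ε hε
    have hcont : Tendsto (deriv β) (𝓝 0) (𝓝 b) := hc.tendsto 0
    obtain ⟨d, hd0, hdd⟩ := (Metric.tendsto_nhds_nhds.1 hcont) (ε/2) (by positivity)
    set δ := min (d/2) (1/2) with hδ
    have hδ0 : 0 < δ := by positivity
    have hδd : δ < d := lt_of_le_of_lt (min_le_left _ _) (by linarith)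
    have hδ1 : δ < 1 := lt_of_le_of_lt (min_le_right _ _) (by norm_num)
    set C := |G δ + b * Real.log δ| with hC
    have hC' : Tendsto (fun r => C * |(Real.log r)⁻¹|) (𝓝[>] (0:ℝ)) (𝓝 0) := by
      simpa using hinv.abs.const_mul C
    have e1 := hC'.eventually (gt_mem_nhds (show (0:ℝ) < ε/2 by positivity))
    filter_upwards [e1, Ioo_mem_nhdsGT hδ0] with r h1 hr
    obtain ⟨hr0, hrδ⟩ := hr
    have hlr : Real.log r < 0 := Real.log_neg hr0 (hrδ.trans hδ1)
    have hlδ : Real.log δ < 0 := Real.log_neg hδ0 hδ1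
    have hir := aux_int β βinf hβ hβmono hβlim r hr0
    have hiδ := aux_int β βinf hβ hβmono hβlim δ hδ0
    have hsub : G r - G δ = ∫ s in r..δ, deriv β s / s :=
      intervalIntegral.integral_Ioi_sub_Ioi hir hrδ.le
    have h0 : (0:ℝ) ∉ Set.uIcc r δ := by
      rw [Set.uIcc_of_le hrδ.le]; intro h; exact absurd h.1 (not_le.2 hr0)
    have hinvI : IntervalIntegrable (fun s : ℝ => s⁻¹) volume r δ :=
      intervalIntegrable_inv_iff.2 (Or.inr h0)
    have hlogint : ∫ s in r..δ, s⁻¹ = Real.log δ - Real.log r := by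
      rw [integral_inv h0, Real.log_div hδ0.ne' hr0.ne']
    have hI1 : IntervalIntegrable (fun s => deriv β s / s) volume r δ :=
      (intervalIntegrable_iff_integrableOn_Ioc_of_le hrδ.le).2
        (hir.mono_set Set.Ioc_subset_Ioi_self)
    have hdiff : (G r + b * Real.log r) - (G δ + b * Real.log δ)
        = ∫ s in r..δ, (deriv β s / s - b * s⁻¹) := by
      rw [intervalIntegral.integral_sub hI1 (hinvI.const_mul b),
        intervalIntegral.integral_const_mul, hlogint, ← hsub]
      ring
    have hbound : ‖∫ s in r..δ, (deriv β s / s - b * s⁻¹)‖ ≤ ∫ s in r..δ, (ε/2) * s⁻¹ := by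
      refine intervalIntegral.norm_integral_le_of_norm_le hrδ.le
        (Eventually.of_forall fun s hs => ?_) (hinvI.const_mul _)
      have hs0 : 0 < s := hr0.trans hs.1
      have := hdd (x := s) (by
        rw [Real.dist_eq, sub_zero, abs_of_pos hs0]; exact hs.2.trans_lt hδd)
      rw [Real.dist_eq] at this
      rw [div_eq_mul_inv, ← sub_mul, Real.norm_eq_abs, abs_mul, abs_of_pos (inv_pos.2 hs0)]
      gcongr
    rw [intervalIntegral.integral_const_mul, hlogint, ← hdiff, Real.norm_eq_abs] at hbound
    have htri : |G r + b * Real.log r| ≤ C + ε/2 * |Real.log r| := by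
      have := abs_add_le ((G r + b * Real.log r) - (G δ + b * Real.log δ)) (G δ + b * Real.log δ)
      rw [sub_add_cancel] at this
      rw [abs_of_neg hlr]
      nlinarith
    rw [Real.dist_eq, sub_zero, abs_mul]
    calc _ ≤ (C + ε/2 * |Real.log r|) * |(Real.log r)⁻¹| := by gcongr
      _ = C * |(Real.log r)⁻¹| + ε/2 := by
        rw [abs_inv]
        have : |Real.log r| ≠ 0 := abs_ne_zero.2 hlr.ne
        field_simp
      _ < ε := by linarith
  have hfin := ((hq.mul hinv).neg.sub key).add_const b
  simp only [mul_zero, neg_zero, sub_zero, zero_add] at hfin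
  refine hfin.congr' ?_
  filter_upwards [Ioo_mem_nhdsGT (show (0:ℝ) < 1 by norm_num)] with r hr
  have hlr : Real.log r ≠ 0 := (Real.log_neg hr.1 hr.2).ne
  have hr0 : r ≠ 0 := hr.1.ne'
  have : Edens β r = -β r - r * G r := rfl
  rw [this]
  field_simp
  ring
end
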